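/- Every cyclic word in letters a, b, a⁻¹, b⁻¹ yields by elementary cancellations a unique economical word: if w is such a cyclic word and u, v are economical cyclic words each obtainable from w by a finite sequence of elementary cancellations, then u = v as cyclic words (i.e., u is a cyclic rotation of v). -/

import Mathlib

/-- The four-letter alphabet `{a, b, a⁻¹, b⁻¹}`: `(0, true) = a`, `(0, false) = a⁻¹`,
`(1, true) = b`, `(1, false) = b⁻¹`. -/
abbrev L4 : Type := Fin 2 × Bool

/-- The letter inverse to a given letter (`a ↔ a⁻¹`, `b ↔ b⁻¹`). -/
def invL (x : L4) : L4 := (x.1, !x.2)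

/-- Equality of words up to cyclic rotation (equality as cyclic words). -/
def CycEq {α : Type*} (w₁ w₂ : List α) : Prop := ∃ n : ℕ, w₂ = w₁.rotate n

/-- The letter at the position cyclically following `i`. -/
def cnext {α : Type*} (w : List α) (i : Fin w.length) : α :=
  w.get ⟨(i.1 + 1) % w.length, Nat.mod_lt _ (Nat.lt_of_le_of_lt (Nat.zero_le _) i.isLt)⟩

/-- Elementary cancellation of a cyclic word in letters `a`, `b`, `a⁻¹`, `b⁻¹`:
deletion of two cyclically adjacent mutually inverse letters. -/
def CancelW (w w' : List L4) : Prop :=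
  ∃ (x : L4) (rest : List L4), CycEq w (x :: invL x :: rest) ∧ CycEq w' rest

/-- A cyclic word is economical if no two cyclically adjacent positions carry
mutually inverse letters. -/
def EconomicalW (w : List L4) : Prop :=
  2 ≤ w.length → ∀ i : Fin w.length, cnext w i ≠ invL (w.get i)

theorem cycEq_iff_isRotated {α : Type*} (w w' : List α) : CycEq w w' ↔ w ~r w' :=
  ⟨fun ⟨n, h⟩ => ⟨n, h.symm⟩, fun ⟨n, h⟩ => ⟨n, h.symm⟩⟩

theorem invL_invL (x : L4) : invL (invL x) = x := by
  simp [invL]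

theorem isRotated_append_swap {α : Type*} (p q : List α) : (p ++ q) ~r (q ++ p) :=
  ⟨p.length, by simp⟩

theorem cancelW_iff (w w' : List L4) :
    CancelW w w' ↔ ∃ x rest, w ~r (x :: invL x :: rest) ∧ w' ~r rest := by
  simp only [CancelW, cycEq_iff_isRotated]

theorem cancelW_left {w w₁ w' : List L4} (h : w ~r w₁) (hc : CancelW w w') : CancelW w₁ w' := by
  rw [cancelW_iff] at *
  obtain ⟨x, r, h1, h2⟩ := hc
  exact ⟨x, r, h.symm.trans h1, h2⟩

theorem isRotated_split {α : Type*} {l m : List α} (h : l ~r m) :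
    ∃ A B, l = A ++ B ∧ m = B ++ A := by
  obtain ⟨n, hn, rfl⟩ := List.isRotated_iff_mod.1 h
  exact ⟨l.take n, l.drop n, by simp, List.rotate_eq_drop_append_take hn⟩

theorem cancelW_diamond {x y : L4} {r s : List L4}
    (h : (x :: invL x :: r) ~r (y :: invL y :: s)) :
    r ~r s ∨ ∃ z, CancelW r z ∧ CancelW s z := by
  obtain ⟨A, B, h1, h2⟩ := isRotated_split h
  match A, B, h1, h2 with
  | [], B, h1, h2 =>
    left
    simp only [List.nil_append, List.append_nil] at h1 h2
    rw [← h1] at h2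
    simp only [List.cons.injEq] at h2
    rw [h2.2.2]
  | A, [], h1, h2 =>
    left
    simp only [List.nil_append, List.append_nil] at h1 h2
    rw [← h1] at h2
    simp only [List.cons.injEq] at h2
    rw [h2.2.2]
  | [a], [b], h1, h2 =>
    simp at h1 h2
    left
    rw [h1.2.2, h2.2.2]
  | [a], b :: c :: q, h1, h2 =>
    left
    simp only [List.cons_append, List.nil_append, List.cons.injEq] at h1 h2
    obtain ⟨rfl, rfl, rfl⟩ := h1
    obtain ⟨rfl, rfl, rfl⟩ := h2
    rw [invL_invL]
    exact isRotated_append_swap [x] q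
  | a :: c :: p, [b], h1, h2 =>
    left
    simp only [List.cons_append, List.nil_append, List.cons.injEq] at h1 h2
    obtain ⟨rfl, rfl, rfl⟩ := h1
    obtain ⟨rfl, h3, rfl⟩ := h2
    rw [← h3, invL_invL]
    exact isRotated_append_swap p [y]
  | a :: c :: p, b :: d :: q, h1, h2 =>
    right
    simp only [List.cons_append, List.cons.injEq] at h1 h2
    obtain ⟨rfl, rfl, rfl⟩ := h1
    obtain ⟨rfl, rfl, rfl⟩ := h2
    refine ⟨p ++ q, ?_, ?_⟩
    · rw [cancelW_iff]
      exact ⟨y, q ++ p, isRotated_append_swap p (y :: invL y :: q), isRotated_append_swap p q⟩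
    · rw [cancelW_iff]
      exact ⟨x, p ++ q, isRotated_append_swap q (x :: invL x :: p), List.IsRotated.refl _⟩

theorem economicalW_irred {u z : List L4} (h : EconomicalW u) : ¬ CancelW u z := by
  rintro ⟨x, r, ⟨n, hn⟩, -⟩
  have hl : u.length = r.length + 2 := by
    have := congrArg List.length hn
    simp at this
    omega
  have hpos : 0 < u.length := by omega
  have h0 : (u.rotate n)[0]? = some x := by rw [← hn]; rfl
  have h1 : (u.rotate n)[1]? = some (invL x) := by rw [← hn]; rfl
  rw [List.getElem?_rotate (by omega)] at h0 h1
  have := h (by omega) ⟨n % u.length, Nat.mod_lt _ hpos⟩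
  apply this
  rw [List.getElem?_eq_getElem (Nat.mod_lt _ hpos)] at h0 h1
  simp only [Option.some.injEq, zero_add] at h0 h1
  simp only [cnext, List.get_eq_getElem, Nat.mod_add_mod]
  rw [h0, ← h1]
  simp only [add_comm]

/-- Cancellation or rotation. -/
def StepR (w w' : List L4) : Prop := CancelW w w' ∨ w ~r w'

theorem stepR_irred {u d : List L4} (h : EconomicalW u) (hd : Relation.ReflTransGen StepR u d) :
    u ~r d := by
  induction hd with
  | refl => exact List.IsRotated.refl _
  | tail _ hs ih =>
    rcases hs with hs | hs
    · exact absurd (cancelW_left ih.symm hs) (economicalW_irred h)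
    · exact ih.trans hs

theorem stepR_diamond (a b c : List L4) (hb : StepR a b) (hc : StepR a c) :
    ∃ d, Relation.ReflGen StepR b d ∧ Relation.ReflTransGen StepR c d := by
  rcases hb with hb | hb
  · rcases hc with hc | hc
    · rw [cancelW_iff] at hb hc
      obtain ⟨x, r, h1, h2⟩ := hb
      obtain ⟨y, s, h3, h4⟩ := hc
      rcases cancelW_diamond (h1.symm.trans h3) with h | ⟨z, h5, h6⟩
      · exact ⟨c, .single (Or.inr (h2.trans (h.trans h4.symm))), .refl⟩
      · exact ⟨z, .single (Or.inl (cancelW_left h2.symm h5)),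
          .single (Or.inl (cancelW_left h4.symm h6))⟩
    · exact ⟨b, .refl, .single (Or.inl (cancelW_left hc hb))⟩
  · rcases hc with hc | hc
    · exact ⟨c, .single (Or.inl (cancelW_left hb hc)), .refl⟩
    · exact ⟨c, .single (Or.inr (hb.symm.trans hc)), .refl⟩

/-- a cyclic word in letters `a`, `b`, `a⁻¹`, `b⁻¹` yields by
elementary cancellations a unique economical word (unique as a cyclic word). -/
theorem economical_form_unique_inv (w u v : List L4)
    (hu : Relation.ReflTransGen CancelW w u) (hv : Relation.ReflTransGen CancelW w v)
    (heu : EconomicalW u) (hev : EconomicalW v) : CycEq u v := by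
  have hu' : Relation.ReflTransGen StepR w u := Relation.ReflTransGen.mono (p := StepR) (fun _ _ h => Or.inl h) _ _ hu
  have hv' : Relation.ReflTransGen StepR w v := Relation.ReflTransGen.mono (p := StepR) (fun _ _ h => Or.inl h) _ _ hv
  obtain ⟨d, h1, h2⟩ := Relation.church_rosser stepR_diamond hu' hv'
  rw [cycEq_iff_isRotated]
  exact (stepR_irred heu h1).trans (stepR_irred hev h2).symm
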